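/- arXiv:1508.05513 — 2 statements merged into one kernel-verified Lean document; each statement's English description precedes it below -/
import Mathlib

section
/- The function r ↦ (1 − (2/π)E(r)) / (1 − S_{5/2,2}(1, √(1−r²))) is strictly increasing on (0,1), with limit 1 as r → 0⁺ and limit 25(π−2)/(9π) as r → 1⁻, where E is the complete elliptic integral of the second kind and S_{5/2,2}(1,x) = ((4/5)(1−x^{5/2})/(1−x²))². -/
open Real

/-- Complete elliptic integral of the second kind. -/
noncomputable def ellipticE (r : ℝ) : ℝ :=
  ∫ t in (0:ℝ)..(π / 2), Real.sqrt (1 - r ^ 2 * Real.sin t ^ 2)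

/-- The Stolarsky mean `S_{5/2,2}(1,x)`. -/
noncomputable def S52 (x : ℝ) : ℝ := (4 / 5 * (1 - x ^ ((5:ℝ) / 2)) / (1 - x ^ 2)) ^ 2

/-- The coefficient of `u ^ n` in `(1 - u) ^ (-a)`. -/
noncomputable def negBinom (a : ℝ) (n : ℕ) : ℝ :=
  ∏ i ∈ Finset.range n, (a + i) / (i + 1)

lemma negBinom_succ (a : ℝ) (n : ℕ) :
    negBinom a (n + 1) = negBinom a n * ((a + n) / (n + 1)) :=
  Finset.prod_range_succ _ _

lemma choose_eq_negBinom (a : ℝ) (n : ℕ) : Ring.choose (a + n - 1) n = negBinom a n := by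
  have h : Ring.choose (a + n - 1) n = Ring.multichoose a n := by
    rw [Ring.choose]; congr 1; ring
  have key : ∀ n : ℕ, (n.factorial : ℝ) * negBinom a n = (ascPochhammer ℕ n).smeval a := by
    intro n
    induction n with
    | zero => simp [negBinom]
    | succ k ih =>
      rw [ascPochhammer_succ_right, Polynomial.smeval_mul, ← ih, negBinom_succ,
        Nat.factorial_succ, Polynomial.smeval_add, Polynomial.smeval_X,
        ← Polynomial.C_eq_natCast, Polynomial.smeval_C]
      push_cast
      simp only [pow_one, pow_zero, nsmul_eq_mul, mul_one]
      field_simp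
  have hf : (n.factorial : ℝ) ≠ 0 := by positivity
  have h2 := Ring.factorial_nsmul_multichoose_eq_ascPochhammer a n
  rw [← key, nsmul_eq_mul] at h2
  rw [h]
  exact mul_left_cancel₀ hf h2

lemma hasSum_negBinom (a : ℝ) {u : ℝ} (h0 : 0 ≤ u) (h1 : u < 1) :
    HasSum (fun n => negBinom a n * u ^ n) ((1 - u) ^ (-a)) := by
  have h := (Real.one_div_one_sub_rpow_hasFPowerSeriesOnBall_zero a).hasSum (y := u) (by
    simp [enorm_eq_nnnorm, ← NNReal.coe_lt_coe, abs_of_nonneg h0, h1])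
  simp only [zero_add, FormalMultilinearSeries.ofScalars_apply_eq, choose_eq_negBinom,
    smul_eq_mul, one_div] at h
  rwa [Real.rpow_neg (by linarith)]

/-- Coefficients of `(1 - 2 / π * ellipticE r) / r ^ 2` as a power series in `r ^ 2`. -/
noncomputable def ellipticCoeff (n : ℕ) : ℝ :=
  -(negBinom (-1 / 2) (n + 1) * negBinom (1 / 2) (n + 1))

/-- Coefficients of `(1 - S52 (√(1 - r ^ 2))) / r ^ 2` as a power series in `r ^ 2`. -/
noncomputable def stolarskyCoeff (n : ℕ) : ℝ :=
  16 / 25 * (2 * negBinom (-5 / 4) (n + 3) - negBinom (-5 / 2) (n + 3))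

lemma integral_sin_pow_even_half (n : ℕ) :
    ∫ t in (0 : ℝ)..(π / 2), sin t ^ (2 * n) = π / 2 * negBinom (1 / 2) n := by
  have h := intervalIntegral.integral_comp_sub_left (a := 0) (b := π / 2)
    (fun t => cos t ^ (2 * n)) (π / 2)
  simp only [cos_pi_div_two_sub, sub_self, sub_zero] at h
  rw [h, EulerSine.integral_cos_pow_eq, integral_sin_pow_even, negBinom, ← mul_assoc, one_div_mul_eq_div]
  congr 1
  refine Finset.prod_congr rfl fun i _ => ?_
  field_simp
  ring

lemma hasSum_ellipticE {r : ℝ} (hr : r ∈ Set.Ioo (0 : ℝ) 1) :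
    HasSum (fun n => negBinom (-1 / 2) n * negBinom (1 / 2) n * (r ^ 2) ^ n)
      (2 / π * ellipticE r) := by
  have hu0 : 0 ≤ r ^ 2 := by positivity
  have hu1 : r ^ 2 < 1 := by nlinarith [hr.1, hr.2]
  have hs (t : ℝ) : 0 ≤ r ^ 2 * sin t ^ 2 ∧ r ^ 2 * sin t ^ 2 ≤ r ^ 2 :=
    ⟨by positivity, mul_le_of_le_one_right hu0 (sin_sq_le_one t)⟩
  have hsum := (hasSum_negBinom (-1 / 2) hu0 hu1).summable.abs
  have h := intervalIntegral.hasSum_integral_of_dominated_convergence (a := 0) (b := π / 2)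
    (μ := MeasureTheory.volume)
    (F := fun n t => negBinom (-1 / 2) n * (r ^ 2 * sin t ^ 2) ^ n)
    (f := fun t => Real.sqrt (1 - r ^ 2 * sin t ^ 2))
    (fun n _ => |negBinom (-1 / 2) n * (r ^ 2) ^ n|)
    (fun n => Continuous.aestronglyMeasurable (by fun_prop))
    (fun n => Filter.Eventually.of_forall fun t _ => by
      rw [Real.norm_eq_abs, abs_mul, abs_mul, abs_of_nonneg (pow_nonneg (hs t).1 n),
        abs_of_nonneg (pow_nonneg hu0 n)]
      exact mul_le_mul_of_nonneg_left (pow_le_pow_left₀ (hs t).1 (hs t).2 n) (abs_nonneg _))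
    (Filter.Eventually.of_forall fun t _ => hsum)
    (by simp)
    (Filter.Eventually.of_forall fun t _ => by
      have := hasSum_negBinom (-1 / 2) (hs t).1 ((hs t).2.trans_lt hu1)
      rw [Real.sqrt_eq_rpow]
      convert! this using 2
      norm_num)
  convert! h.mul_left (2 / π) using 2 with n
  simp_rw [mul_pow, ← pow_mul]
  rw [intervalIntegral.integral_const_mul, intervalIntegral.integral_const_mul,
    integral_sin_pow_even_half]
  field_simp

lemma hasSum_ellipticCoeff {r : ℝ} (hr : r ∈ Set.Ioo (0 : ℝ) 1) :
    HasSum (fun n => ellipticCoeff n * (r ^ 2) ^ n) ((1 - 2 / π * ellipticE r) / r ^ 2) := by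
  have h := ((hasSum_nat_add_iff' 1).2 (hasSum_ellipticE hr)).div_const (-(r ^ 2))
  have hr0 : r ≠ 0 := hr.1.ne'
  convert! h using 1
  · ext n
    simp only [ellipticCoeff, pow_succ (r ^ 2) n]
    field_simp
  · simp [negBinom]
    field_simp
    ring

lemma hasSum_stolarskyCoeff {r : ℝ} (hr : r ∈ Set.Ioo (0 : ℝ) 1) :
    HasSum (fun n => stolarskyCoeff n * (r ^ 2) ^ n)
      ((1 - S52 (Real.sqrt (1 - r ^ 2))) / r ^ 2) := by
  have hr0 : r ≠ 0 := hr.1.ne'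
  have hu0 : 0 ≤ r ^ 2 := by positivity
  have hu1 : r ^ 2 < 1 := by nlinarith [hr.1, hr.2]
  have hx : 0 ≤ 1 - r ^ 2 := by linarith
  have h := ((hasSum_nat_add_iff' 3).2 (((hasSum_negBinom (-5 / 4) hu0 hu1).mul_left 2).sub
    (hasSum_negBinom (-5 / 2) hu0 hu1))).mul_left (16 / 25 / (r ^ 2) ^ 3)
  have e1 : (Real.sqrt (1 - r ^ 2)) ^ ((5 : ℝ) / 2) = (1 - r ^ 2) ^ (-(-5 / 4) : ℝ) := by
    rw [Real.sqrt_eq_rpow, ← Real.rpow_mul hx]; norm_num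
  have e2 : (1 - r ^ 2) ^ (-(-5 / 2) : ℝ) = ((1 - r ^ 2) ^ (-(-5 / 4) : ℝ)) ^ 2 := by
    rw [← Real.rpow_mul_natCast hx]; norm_num
  convert! h using 1
  · ext n
    simp only [stolarskyCoeff, pow_add]
    field_simp
  · rw [S52, e1, e2, Real.sq_sqrt hx]
    simp only [Finset.sum_range_succ, negBinom, Finset.prod_range_succ, Finset.sum_range_zero,
      Finset.prod_range_zero]
    generalize (1 - r ^ 2) ^ (-(-5 / 4) : ℝ) = y
    rw [sub_sub_cancel]
    push_cast
    field_simp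
    ring

lemma ellipticCoeff_zero : ellipticCoeff 0 = 1 / 4 := by
  norm_num [ellipticCoeff, negBinom]

lemma ellipticCoeff_succ (n : ℕ) : ellipticCoeff (n + 1) =
    ellipticCoeff n * ((n + 1 / 2) * (n + 3 / 2) / (n + 2) ^ 2) := by
  rw [ellipticCoeff, ellipticCoeff, negBinom_succ _ (n + 1), negBinom_succ _ (n + 1)]
  push_cast
  field_simp
  ring

lemma ellipticCoeff_pos (n : ℕ) : 0 < ellipticCoeff n := by
  induction n with
  | zero => norm_num [ellipticCoeff_zero]
  | succ n ih => rw [ellipticCoeff_succ]; positivity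

lemma ellipticCoeff_le (n : ℕ) : ellipticCoeff n ≤ 1 / 4 := by
  induction n with
  | zero => rw [ellipticCoeff_zero]
  | succ n ih =>
    rw [ellipticCoeff_succ]
    refine (mul_le_of_le_one_right (ellipticCoeff_pos n).le ?_).trans ih
    rw [div_le_one (by positivity)]
    nlinarith

lemma negBinom_five_fourths_pos (n : ℕ) : 0 < negBinom (-5 / 4) (n + 3) := by
  induction n with
  | zero => norm_num [negBinom, Finset.prod_range_succ]
  | succ n ih =>
    rw [negBinom_succ _ (n + 3)]
    refine mul_pos ih (div_pos ?_ (by positivity))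
    push_cast
    linarith [n.cast_nonneg (α := ℝ)]

lemma negBinom_five_halves_neg (n : ℕ) : negBinom (-5 / 2) (n + 3) < 0 := by
  induction n with
  | zero => norm_num [negBinom, Finset.prod_range_succ]
  | succ n ih =>
    rw [negBinom_succ _ (n + 3)]
    refine mul_neg_of_neg_of_pos ih (div_pos ?_ (by positivity))
    push_cast
    linarith [n.cast_nonneg (α := ℝ)]

lemma stolarskyCoeff_pos (n : ℕ) : 0 < stolarskyCoeff n := by
  have := negBinom_five_fourths_pos n
  have := negBinom_five_halves_neg n
  rw [stolarskyCoeff]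
  linarith

lemma stolarskyCoeff_succ_le (n : ℕ) : stolarskyCoeff (n + 1) ≤
    stolarskyCoeff n * ((n + 1 / 2) * (n + 3 / 2) / (n + 2) ^ 2) := by
  have hp := negBinom_five_fourths_pos n
  have hq := negBinom_five_halves_neg n
  have key : 0 ≤ -negBinom (-5 / 2) (n + 3) * ((n + 1 / 2) * (3 / 2 * n + 2)) +
      2 * negBinom (-5 / 4) (n + 3) * (n ^ 2 / 4 - 9 / 4 * n - 4) := by
    by_cases hn : n < 11
    · clear hp hq
      interval_cases n <;> norm_num [negBinom, Finset.prod_range_succ]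
    · have hn' : (11 : ℝ) ≤ n := by exact_mod_cast not_lt.1 hn
      have h1 : 0 ≤ (n : ℝ) ^ 2 / 4 - 9 / 4 * n - 4 := by nlinarith
      have h2 : 0 ≤ -negBinom (-5 / 2) (n + 3) := by linarith
      positivity
  rw [stolarskyCoeff, stolarskyCoeff, negBinom_succ _ (n + 3), negBinom_succ _ (n + 3)]
  rw [← sub_nonneg]
  have : 0 ≤ 16 / 25 / ((n + 2) ^ 2 * (n + 4)) *
    (-negBinom (-5 / 2) (n + 3) * ((n + 1 / 2) * (3 / 2 * n + 2)) +
      2 * negBinom (-5 / 4) (n + 3) * (n ^ 2 / 4 - 9 / 4 * n - 4)) :=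
    mul_nonneg (by positivity) key
  convert! this using 1
  push_cast
  field_simp
  ring

lemma monotone_coeff_ratio : Monotone fun n => ellipticCoeff n / stolarskyCoeff n := by
  refine monotone_nat_of_le_succ fun n => ?_
  rw [div_le_div_iff₀ (stolarskyCoeff_pos _) (stolarskyCoeff_pos _), ellipticCoeff_succ]
  have := mul_le_mul_of_nonneg_left (stolarskyCoeff_succ_le n) (ellipticCoeff_pos n).le
  linarith

lemma stolarskyCoeff_zero : stolarskyCoeff 0 = 1 / 4 := by
  norm_num [stolarskyCoeff, negBinom, Finset.prod_range_succ]

lemma stolarskyCoeff_le_ellipticCoeff (n : ℕ) : stolarskyCoeff n ≤ ellipticCoeff n := by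
  have h := monotone_coeff_ratio (Nat.zero_le n)
  simp only [ellipticCoeff_zero, stolarskyCoeff_zero] at h
  rwa [div_self (by norm_num), one_le_div (stolarskyCoeff_pos n)] at h

/-- A quotient of power series with nonnegative coefficients increases when the quotient of the
coefficients is monotone and not constant. -/
lemma cross_lt_of_monotone_ratio {a b : ℕ → ℝ} (ha : ∀ n, 0 ≤ a n) (hb : ∀ n, 0 < b n)
    (hab : Monotone fun n => a n / b n) {k : ℕ} (hk : a 0 / b 0 < a k / b k)
    {u v Au Av Bu Bv : ℝ} (hu : 0 < u) (huv : u < v)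
    (hAu : HasSum (fun n => a n * u ^ n) Au) (hAv : HasSum (fun n => a n * v ^ n) Av)
    (hBu : HasSum (fun n => b n * u ^ n) Bu) (hBv : HasSum (fun n => b n * v ^ n) Bv) :
    Au * Bv < Av * Bu := by
  have hv : 0 < v := hu.trans huv
  have prod {x y X Y : ℝ} (hx : 0 < x) (hy : 0 < y) (hX : HasSum (fun n => a n * x ^ n) X)
      (hY : HasSum (fun n => b n * y ^ n) Y) :
      HasSum (fun p : ℕ × ℕ => a p.1 * x ^ p.1 * (b p.2 * y ^ p.2)) (X * Y) :=
    hX.mul hY (hX.summable.mul_of_nonneg hY.summable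
      (fun n => mul_nonneg (ha n) (by positivity))
      (fun n => mul_nonneg (hb n).le (by positivity)))
  have h1 := prod hv hu hAv hBu
  have h2 := prod hu hv hAu hBv
  have h1' := (Equiv.prodComm ℕ ℕ).hasSum_iff.2 h1
  have h2' := (Equiv.prodComm ℕ ℕ).hasSum_iff.2 h2
  have hT := (h1.add h1').sub (h2.add h2')
  have hcoef {m n : ℕ} (h : m ≤ n) : a m * b n ≤ a n * b m := by
    have := hab h
    rwa [div_le_div_iff₀ (hb m) (hb n)] at this
  have hpow {m n : ℕ} (h : m ≤ n) : v ^ m * u ^ n ≤ u ^ m * v ^ n := by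
    obtain ⟨d, rfl⟩ := Nat.exists_eq_add_of_le h
    have := pow_le_pow_left₀ hu.le huv.le d
    calc v ^ m * u ^ (m + d) = v ^ m * u ^ m * u ^ d := by ring
      _ ≤ v ^ m * u ^ m * v ^ d := by gcongr
      _ = u ^ m * v ^ (m + d) := by ring
  have hpos : 0 < Av * Bu + Av * Bu - (Au * Bv + Au * Bv) := by
    refine hasSum_lt (i := ((0, k) : ℕ × ℕ)) ?_ ?_ hasSum_zero hT
    · rintro ⟨m, n⟩
      simp only [Function.comp, Equiv.prodComm_apply, Prod.swap]
      have : 0 ≤ (a n * b m - a m * b n) * (u ^ m * v ^ n - v ^ m * u ^ n) := by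
        rcases le_total m n with h | h
        · exact mul_nonneg (sub_nonneg.2 (hcoef h)) (sub_nonneg.2 (hpow h))
        · have h3 := hpow h
          exact mul_nonneg_of_nonpos_of_nonpos (sub_nonpos.2 (hcoef h)) (by linarith)
      linarith
    · rw [div_lt_div_iff₀ (hb 0) (hb k)] at hk
      have hk0 : k ≠ 0 := by rintro rfl; exact lt_irrefl _ hk
      have h3 := pow_lt_pow_left₀ huv hu.le hk0
      have := mul_pos (sub_pos.2 hk) (sub_pos.2 h3)
      simp only [Function.comp, Equiv.prodComm_apply, Prod.swap, pow_zero]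
      linarith
  linarith

lemma one_sub_S52_ge {r : ℝ} (hr : r ∈ Set.Ioo (0 : ℝ) 1) :
    r ^ 2 / 4 ≤ 1 - S52 (Real.sqrt (1 - r ^ 2)) := by
  have hr2 : 0 < r ^ 2 := pow_pos hr.1 2
  have h := le_hasSum (hasSum_stolarskyCoeff hr) 0 fun n _ =>
    mul_nonneg (stolarskyCoeff_pos n).le (by positivity)
  rw [stolarskyCoeff_zero, le_div_iff₀ hr2] at h
  linarith

lemma stolarsky_le_elliptic {r : ℝ} (hr : r ∈ Set.Ioo (0 : ℝ) 1) :
    1 - S52 (Real.sqrt (1 - r ^ 2)) ≤ 1 - 2 / π * ellipticE r := by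
  have hr2 : 0 < r ^ 2 := pow_pos hr.1 2
  refine (div_le_div_iff_of_pos_right hr2).1 ?_
  exact hasSum_le (fun n => mul_le_mul_of_nonneg_right (stolarskyCoeff_le_ellipticCoeff n)
    (by positivity)) (hasSum_stolarskyCoeff hr) (hasSum_ellipticCoeff hr)

lemma elliptic_le {r : ℝ} (hr : r ∈ Set.Ioo (0 : ℝ) 1) :
    1 - 2 / π * ellipticE r ≤ r ^ 2 / 4 * (1 - r ^ 2)⁻¹ := by
  have hr2 : 0 < r ^ 2 := pow_pos hr.1 2
  have hr1 : r ^ 2 < 1 := by nlinarith [hr.1, hr.2]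
  have h := hasSum_le (fun n => mul_le_mul_of_nonneg_right (ellipticCoeff_le n)
    (by positivity)) (hasSum_ellipticCoeff hr)
    ((hasSum_geometric_of_lt_one hr2.le hr1).mul_left (1 / 4))
  rw [div_le_iff₀ hr2] at h
  linarith

lemma continuous_ellipticE : Continuous ellipticE :=
  intervalIntegral.continuous_parametric_intervalIntegral_of_continuous'
    (by fun_prop) _ _

lemma ellipticE_one : ellipticE 1 = 1 := by
  have : ellipticE 1 = ∫ t in (0 : ℝ)..(π / 2), cos t := by
    refine intervalIntegral.integral_congr fun t ht => ?_
    rw [Set.uIcc_of_le (by positivity)] at ht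
    have hc : 0 ≤ cos t := cos_nonneg_of_mem_Icc ⟨by linarith [ht.1, pi_pos], ht.2⟩
    simp only [one_pow, one_mul]
    rw [← cos_sq', Real.sqrt_sq hc]
  rw [this]
  simp

theorem G_strict_mono :
    StrictMonoOn (fun r : ℝ => (1 - 2 / π * ellipticE r) / (1 - S52 (Real.sqrt (1 - r ^ 2))))
      (Set.Ioo 0 1) ∧
    Filter.Tendsto (fun r : ℝ => (1 - 2 / π * ellipticE r) / (1 - S52 (Real.sqrt (1 - r ^ 2))))
      (nhdsWithin 0 (Set.Ioi 0)) (nhds 1) ∧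
    Filter.Tendsto (fun r : ℝ => (1 - 2 / π * ellipticE r) / (1 - S52 (Real.sqrt (1 - r ^ 2))))
      (nhdsWithin 1 (Set.Iio 1)) (nhds (25 * (π - 2) / (9 * π))) := by
  have hpos {r : ℝ} (hr : r ∈ Set.Ioo (0 : ℝ) 1) : 0 < 1 - S52 (Real.sqrt (1 - r ^ 2)) :=
    (div_pos (pow_pos hr.1 2) four_pos).trans_le (one_sub_S52_ge hr)
  refine ⟨?_, ?_, ?_⟩
  · intro r hr s hs hrs
    have hr2 : 0 < r ^ 2 := pow_pos hr.1 2
    have hs2 : 0 < s ^ 2 := pow_pos hs.1 2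
    have h := cross_lt_of_monotone_ratio (fun n => (ellipticCoeff_pos n).le) stolarskyCoeff_pos
      monotone_coeff_ratio (k := 3)
      (by norm_num [ellipticCoeff, stolarskyCoeff, negBinom, Finset.prod_range_succ])
      hr2 (pow_lt_pow_left₀ hrs hr.1.le two_ne_zero)
      (hasSum_ellipticCoeff hr) (hasSum_ellipticCoeff hs)
      (hasSum_stolarskyCoeff hr) (hasSum_stolarskyCoeff hs)
    rw [div_mul_div_comm, div_mul_div_comm, mul_comm (s ^ 2),
      div_lt_div_iff_of_pos_right (mul_pos hr2 hs2)] at h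
    exact (div_lt_div_iff₀ (hpos hr) (hpos hs)).2 h
  · have hev : ∀ᶠ r : ℝ in nhdsWithin 0 (Set.Ioi 0), r ∈ Set.Ioo (0 : ℝ) 1 :=
      Ioo_mem_nhdsGT one_pos
    have hlim : Filter.Tendsto (fun r : ℝ => (1 - r ^ 2)⁻¹) (nhdsWithin 0 (Set.Ioi 0))
        (nhds 1) := by
      have : ContinuousAt (fun r : ℝ => (1 - r ^ 2)⁻¹) 0 := by
        refine ContinuousAt.inv₀ (by fun_prop) (by norm_num)
      simpa [ContinuousAt] using this.tendsto.mono_left nhdsWithin_le_nhds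
    refine tendsto_of_tendsto_of_tendsto_of_le_of_le' tendsto_const_nhds hlim ?_ ?_
    · filter_upwards [hev] with r hr
      exact (one_le_div (hpos hr)).2 (stolarsky_le_elliptic hr)
    · filter_upwards [hev] with r hr
      have hr1 : r ^ 2 < 1 := by nlinarith [hr.1, hr.2]
      have hinv : 0 ≤ (1 - r ^ 2)⁻¹ := inv_nonneg.2 (by linarith)
      rw [div_le_iff₀ (hpos hr)]
      have := mul_le_mul_of_nonneg_left (one_sub_S52_ge hr) hinv
      linarith [elliptic_le hr]
  · have hS : ContinuousAt S52 0 := by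
      unfold S52
      have h1 : ContinuousAt (fun x : ℝ => x ^ ((5 : ℝ) / 2)) 0 :=
        Real.continuousAt_rpow_const _ _ (Or.inr (by norm_num))
      refine (ContinuousAt.div (by fun_prop) (by fun_prop) (by norm_num)).pow 2
    have hS0 : S52 0 = 16 / 25 := by
      rw [S52, Real.zero_rpow (by norm_num)]; norm_num
    have hx : ContinuousAt (fun r : ℝ => Real.sqrt (1 - r ^ 2)) 1 := by fun_prop
    have hx1 : Real.sqrt (1 - 1 ^ 2) = 0 := by norm_num
    have hSx : ContinuousAt (fun r : ℝ => S52 (Real.sqrt (1 - r ^ 2))) 1 :=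
      ContinuousAt.comp (g := S52) (by rwa [hx1]) hx
    have hE := continuous_ellipticE
    have h : ContinuousAt (fun r : ℝ => (1 - 2 / π * ellipticE r) /
        (1 - S52 (Real.sqrt (1 - r ^ 2)))) 1 := by
      refine ContinuousAt.div (by fun_prop) (by fun_prop) ?_
      rw [hx1, hS0]; norm_num
    have h2 := h.tendsto.mono_left (nhdsWithin_le_nhds (s := Set.Iio 1))
    rw [hx1, hS0, ellipticE_one] at h2
    convert! h2 using 2
    field_simp
    ring
end

section
/- For all r ∈ (0,1), S_{5/2,2}(1, √(1−r²)) > (2/π) E(r) > (25/(8π)) S_{5/2,2}(1, √(1−r²)), where E is the complete elliptic integral of the second kind and S_{5/2,2}(1,x) = ((4/5)(1−x^{5/2})/(1−x²))². -/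
open Real

theorem hasSum_choose_half_mul_pow {z : ℂ} (hz : ‖z‖ < 1) :
    HasSum (fun n : ℕ => ((Ring.choose (1 / 2 : ℝ) n : ℝ) : ℂ) * z ^ n) ((1 + z) ^ (1 / 2 : ℂ)) := by
  have h := (Complex.one_add_cpow_hasFPowerSeriesOnBall_zero (a := (1 / 2 : ℂ))).hasSum
    (y := z) (by simpa [enorm_eq_nnnorm, ← NNReal.coe_lt_coe] using hz)
  simpa [binomialSeries, FormalMultilinearSeries.coeff_ofScalars, Complex.ofReal_choose,
    mul_comm] using h

theorem summable_norm_choose_half_mul_pow {z : ℂ} (hz : ‖z‖ < 1) :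
    Summable fun n : ℕ => ‖((Ring.choose (1 / 2 : ℝ) n : ℝ) : ℂ) * z ^ n‖ := by
  have h := (binomialSeries ℂ (1 / 2 : ℂ)).summable_norm_apply (x := z) (by
    refine Metric.mem_eball.2 (lt_of_lt_of_le ?_ binomialSeries_radius_ge_one)
    simpa [enorm_eq_nnnorm, ← NNReal.coe_lt_coe] using hz)
  refine h.congr fun n => ?_
  have e : Ring.choose (1 / 2 : ℂ) n = ((Ring.choose (1 / 2 : ℝ) n : ℝ) : ℂ) := by
    rw [Complex.ofReal_choose]
    norm_num
  simp only [binomialSeries, FormalMultilinearSeries.ofScalars_apply_eq, e, smul_eq_mul]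

theorem norm_sq_cpow_half (w : ℂ) : ‖w ^ (1 / 2 : ℂ)‖ ^ 2 = ‖w‖ := by
  rw [← norm_pow, ← Complex.cpow_nat_mul]
  simp

theorem hasSum_re_mul_conj {f : ℕ → ℂ} {s : ℂ} (h : HasSum f s)
    (hs : Summable fun n => ‖f n‖) :
    HasSum (fun p : ℕ × ℕ => (f p.1 * (starRingEnd ℂ) (f p.2)).re) (Complex.normSq s) := by
  have h2 : HasSum (fun n => (starRingEnd ℂ) (f n)) ((starRingEnd ℂ) s) :=
    h.map (starRingEnd ℂ) Complex.continuous_conj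
  have hs2 : Summable fun n => ‖(starRingEnd ℂ) (f n)‖ := by simpa using hs
  have hp : Summable fun p : ℕ × ℕ => f p.1 * (starRingEnd ℂ) (f p.2) :=
    summable_mul_of_summable_norm (g := fun n => (starRingEnd ℂ) (f n)) hs hs2
  have h3 := h.mul h2 hp
  have h4 := Complex.hasSum_re h3
  rwa [Complex.mul_conj, Complex.ofReal_re] at h4

theorem hasSum_norm_one_add_mul_exp {l : ℝ} (hl0 : 0 ≤ l) (hl1 : l < 1) (t : ℝ) :
    HasSum (fun p : ℕ × ℕ => (Ring.choose (1 / 2 : ℝ) p.1 * l ^ p.1) *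
      (Ring.choose (1 / 2 : ℝ) p.2 * l ^ p.2) * Real.cos (2 * ((p.1 : ℝ) - p.2) * t))
      ‖1 + l * Complex.exp ((2 * t : ℝ) * Complex.I)‖ := by
  set z : ℂ := l * Complex.exp ((2 * t : ℝ) * Complex.I) with hzdef
  have hz : ‖z‖ < 1 := by
    rw [hzdef, norm_mul, Complex.norm_exp_ofReal_mul_I]
    simpa [abs_of_nonneg hl0] using hl1
  have h1 := hasSum_choose_half_mul_pow hz
  have hs1 := summable_norm_choose_half_mul_pow hz
  have h4 := hasSum_re_mul_conj h1 hs1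
  rw [Complex.normSq_eq_norm_sq, norm_sq_cpow_half] at h4
  refine h4.congr_fun fun p => ?_
  have e1 : z ^ p.1 * (starRingEnd ℂ) (z ^ p.2) =
      ((l ^ p.1 * l ^ p.2 : ℝ) : ℂ) *
        Complex.exp ((2 * ((p.1 : ℝ) - p.2) * t : ℝ) * Complex.I) := by
    rw [hzdef, map_pow, map_mul, ← Complex.exp_conj, mul_pow, mul_pow, ← Complex.exp_nat_mul,
      ← Complex.exp_nat_mul]
    simp only [map_mul, Complex.conj_ofReal, Complex.conj_I]
    rw [mul_mul_mul_comm, ← Complex.exp_add]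
    push_cast
    congr 2
    ring
  have e2 : ((Ring.choose (1 / 2 : ℝ) p.1 : ℝ) : ℂ) * z ^ p.1 *
      (starRingEnd ℂ) (((Ring.choose (1 / 2 : ℝ) p.2 : ℝ) : ℂ) * z ^ p.2) =
      ((Ring.choose (1 / 2 : ℝ) p.1 * Ring.choose (1 / 2 : ℝ) p.2 *
        (l ^ p.1 * l ^ p.2) : ℝ) : ℂ) *
        Complex.exp ((2 * ((p.1 : ℝ) - p.2) * t : ℝ) * Complex.I) := by
    rw [map_mul, Complex.conj_ofReal, mul_mul_mul_comm, e1]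
    push_cast
    ring
  rw [e2, Complex.re_ofReal_mul, Complex.exp_ofReal_mul_I_re]
  ring

theorem integral_cos_two_mul_sub (m n : ℕ) :
    ∫ t in (0 : ℝ)..(π / 2), Real.cos (2 * ((m : ℝ) - n) * t) = if m = n then π / 2 else 0 := by
  split_ifs with h
  · simp [h]
  · have hmn : (2 * ((m : ℝ) - n)) ≠ 0 := by
      have : (m : ℝ) - n ≠ 0 := sub_ne_zero.2 (by exact_mod_cast h)
      positivity
    rw [intervalIntegral.integral_comp_mul_left (fun x => Real.cos x) hmn, integral_cos]
    have : 2 * ((m : ℝ) - n) * (π / 2) = ((m - n : ℤ) : ℝ) * π := by push_cast; ring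
    rw [this, Real.sin_int_mul_pi]
    simp

theorem hasSum_integral_norm_one_add_mul_exp {l : ℝ} (hl0 : 0 ≤ l) (hl1 : l < 1) :
    HasSum (fun n : ℕ => π / 2 * (Ring.choose (1 / 2 : ℝ) n * l ^ n) ^ 2)
      (∫ t in (0 : ℝ)..(π / 2), ‖1 + l * Complex.exp ((2 * t : ℝ) * Complex.I)‖) := by
  have hs : Summable fun n : ℕ => ‖Ring.choose (1 / 2 : ℝ) n * l ^ n‖ := by
    have := summable_norm_choose_half_mul_pow (z := (l : ℂ)) (by simpa [abs_of_nonneg hl0] using hl1)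
    refine this.congr fun n => ?_
    rw [← Complex.ofReal_pow, ← Complex.ofReal_mul, Complex.norm_real]
  have hs2 := (hs.mul_norm hs)
  have h : HasSum (fun p : ℕ × ℕ => ∫ t in (0 : ℝ)..(π / 2),
      (Ring.choose (1 / 2 : ℝ) p.1 * l ^ p.1) *
      (Ring.choose (1 / 2 : ℝ) p.2 * l ^ p.2) * Real.cos (2 * ((p.1 : ℝ) - p.2) * t))
      (∫ t in (0 : ℝ)..(π / 2), ‖1 + l * Complex.exp ((2 * t : ℝ) * Complex.I)‖) := by
    refine intervalIntegral.hasSum_integral_of_dominated_convergence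
      (fun p _ => ‖(Ring.choose (1 / 2 : ℝ) p.1 * l ^ p.1) *
        (Ring.choose (1 / 2 : ℝ) p.2 * l ^ p.2)‖) (fun p => ?_) (fun p => ?_) ?_ ?_ ?_
    · exact Continuous.aestronglyMeasurable (by fun_prop)
    · refine .of_forall fun t _ => ?_
      rw [norm_mul]
      exact mul_le_of_le_one_right (norm_nonneg _) (Real.abs_cos_le_one _)
    · exact .of_forall fun t _ => by simpa using hs2
    · exact intervalIntegrable_const
    · exact .of_forall fun t _ => hasSum_norm_one_add_mul_exp hl0 hl1 t
  have hinj : Function.Injective fun n : ℕ => (n, n) := fun a b hab => (Prod.ext_iff.1 hab).1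
  have h' := (hinj.hasSum_iff (fun p hp => ?_)).2 h
  · convert h' using 2 with n
    simp only [Function.comp, intervalIntegral.integral_const_mul, integral_cos_two_mul_sub]
    simp
    ring
  · rw [intervalIntegral.integral_const_mul, integral_cos_two_mul_sub, if_neg, mul_zero]
    rintro hp'
    exact hp ⟨p.1, Prod.ext rfl hp'⟩

theorem norm_one_add_mul_exp (l t : ℝ) :
    ‖1 + l * Complex.exp ((2 * t : ℝ) * Complex.I)‖ =
      √(1 + l ^ 2 + 2 * l * Real.cos (2 * t)) := by
  rw [Complex.norm_eq_sqrt_sq_add_sq]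
  congr 1
  simp only [Complex.add_re, Complex.add_im, Complex.one_re, Complex.one_im,
    Complex.re_ofReal_mul, Complex.im_ofReal_mul, Complex.exp_ofReal_mul_I_re,
    Complex.exp_ofReal_mul_I_im]
  linear_combination l ^ 2 * Real.sin_sq_add_cos_sq (2 * t)

theorem ellipticE_eq_integral_norm {r x : ℝ} (hx : 0 ≤ x) (hxr : r ^ 2 = 1 - x ^ 2) :
    ellipticE r = (1 + x) / 2 * ∫ t in (0 : ℝ)..(π / 2),
      ‖1 + ((1 - x) / (1 + x) : ℝ) * Complex.exp ((2 * t : ℝ) * Complex.I)‖ := by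
  rw [ellipticE, ← intervalIntegral.integral_const_mul]
  refine intervalIntegral.integral_congr fun t _ => ?_
  have h1 : 0 < 1 + x := by linarith
  simp only [norm_one_add_mul_exp]
  rw [← Real.sqrt_sq (show 0 ≤ (1 + x) / 2 by positivity), ← Real.sqrt_mul (sq_nonneg _),
    Real.cos_two_mul, Real.cos_sq', hxr]
  congr 1
  field_simp
  ring

theorem integral_norm_one_add_mul_exp_le {l : ℝ} (hl1 : l < 1) :
    ∫ t in (0 : ℝ)..(π / 2), ‖1 + l * Complex.exp ((2 * t : ℝ) * Complex.I)‖ ≤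
      2 + (1 - l) * (π / 2) := by
  have h : ∫ t in (0 : ℝ)..(π / 2), (2 * Real.cos t + (1 - l)) = 2 + (1 - l) * (π / 2) := by
    rw [intervalIntegral.integral_add (Continuous.intervalIntegrable (by fun_prop) _ _)
      (by simp)]
    simp
    ring
  rw [← h]
  refine intervalIntegral.integral_mono_on (by positivity)
    (Continuous.intervalIntegrable (by fun_prop) _ _)
    (Continuous.intervalIntegrable (by fun_prop) _ _) fun t ht => ?_
  have hc : 0 ≤ Real.cos t := Real.cos_nonneg_of_mem_Icc ⟨by linarith [ht.1, Real.pi_pos], ht.2⟩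
  rw [norm_one_add_mul_exp, Real.cos_two_mul]
  refine Real.sqrt_le_iff.2 ⟨by linarith, ?_⟩
  nlinarith [mul_nonneg hc (sub_nonneg.2 hl1.le),
    mul_nonneg (sq_nonneg (Real.cos t)) (sub_nonneg.2 hl1.le)]

theorem sum_choose_half_sq_le (s : Finset ℕ) :
    ∑ n ∈ s, π / 2 * Ring.choose (1 / 2 : ℝ) n ^ 2 ≤ 2 := by
  have hf : Filter.Tendsto
      (fun l : ℝ => ∑ n ∈ s, π / 2 * (Ring.choose (1 / 2 : ℝ) n * l ^ n) ^ 2)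
      (nhdsWithin 1 (Set.Iio 1)) (nhds (∑ n ∈ s, π / 2 * Ring.choose (1 / 2 : ℝ) n ^ 2)) := by
    have : Continuous
        (fun l : ℝ => ∑ n ∈ s, π / 2 * (Ring.choose (1 / 2 : ℝ) n * l ^ n) ^ 2) := by fun_prop
    simpa using (this.tendsto 1).mono_left nhdsWithin_le_nhds
  have hg : Filter.Tendsto (fun l : ℝ => 2 + (1 - l) * (π / 2))
      (nhdsWithin 1 (Set.Iio 1)) (nhds 2) := by
    have : Continuous (fun l : ℝ => 2 + (1 - l) * (π / 2)) := by fun_prop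
    simpa using (this.tendsto 1).mono_left nhdsWithin_le_nhds
  refine le_of_tendsto_of_tendsto hf hg ?_
  filter_upwards [Ioo_mem_nhdsLT (show (0 : ℝ) < 1 by norm_num)] with l hl
  have h := hasSum_integral_norm_one_add_mul_exp hl.1.le hl.2
  exact (sum_le_hasSum s (fun n _ => by positivity) h).trans
    (integral_norm_one_add_mul_exp_le hl.2)

theorem choose_half_values :
    Ring.choose (1 / 2 : ℝ) 0 = 1 ∧ Ring.choose (1 / 2 : ℝ) 1 = 1 / 2 ∧
    Ring.choose (1 / 2 : ℝ) 2 = -(1 / 8) ∧ Ring.choose (1 / 2 : ℝ) 3 = 1 / 16 ∧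
    Ring.choose (1 / 2 : ℝ) 4 = -(5 / 128) := by
  have e2 : (2 : Polynomial ℤ).smeval (2⁻¹ : ℝ) = 2 := by
    simpa using Polynomial.smeval_natCast ℤ (2⁻¹ : ℝ) 2
  have e3 : (3 : Polynomial ℤ).smeval (2⁻¹ : ℝ) = 3 := by
    simpa using Polynomial.smeval_natCast ℤ (2⁻¹ : ℝ) 3
  rw [one_div]
  refine ⟨?_, ?_, ?_, ?_, ?_⟩ <;>
  · rw [Ring.choose_eq_smul]
    simp [descPochhammer_succ_right, Polynomial.smeval_mul, Polynomial.smeval_sub,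
      e2, e3, Nat.factorial]
    try norm_num

theorem le_integral_norm_one_add_mul_exp {l : ℝ} (hl0 : 0 ≤ l) (hl1 : l < 1) :
    π / 2 * (1 + l ^ 2 / 4 + l ^ 4 / 64 + l ^ 6 / 256 + 25 * l ^ 8 / 16384) ≤
      ∫ t in (0 : ℝ)..(π / 2), ‖1 + l * Complex.exp ((2 * t : ℝ) * Complex.I)‖ := by
  have h := sum_le_hasSum (Finset.range 5) (fun n _ => by positivity)
    (hasSum_integral_norm_one_add_mul_exp hl0 hl1)
  obtain ⟨h0, h1, h2, h3, h4⟩ := choose_half_values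
  simp only [Finset.sum_range_succ, Finset.sum_range_zero, h0, h1, h2, h3, h4] at h
  linarith

theorem integral_norm_one_add_mul_exp_le_quartic {l : ℝ} (hl0 : 0 ≤ l) (hl1 : l < 1) :
    ∫ t in (0 : ℝ)..(π / 2), ‖1 + l * Complex.exp ((2 * t : ℝ) * Complex.I)‖ ≤
      π / 2 * (1 + l ^ 2 / 4 + l ^ 4 / 64 + l ^ 6 / 256) +
        l ^ 8 * (2 - π / 2 * (325 / 256)) := by
  have h := hasSum_integral_norm_one_add_mul_exp hl0 hl1
  obtain ⟨h0, h1, h2, h3, -⟩ := choose_half_values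
  refine le_of_tendsto ((Filter.tendsto_add_atTop_iff_nat 4).2 h.tendsto_sum_nat)
    (.of_forall fun N => ?_)
  have hb := sum_choose_half_sq_le (Finset.range (N + 4))
  have htail : ∑ n ∈ Finset.range N, π / 2 * (Ring.choose (1 / 2 : ℝ) (n + 4) * l ^ (n + 4)) ^ 2 ≤
      l ^ 8 * ∑ n ∈ Finset.range N, π / 2 * Ring.choose (1 / 2 : ℝ) (n + 4) ^ 2 := by
    rw [Finset.mul_sum]
    refine Finset.sum_le_sum fun n _ => ?_
    have hl : (l ^ n) ^ 2 ≤ 1 := pow_le_one₀ (by positivity) (pow_le_one₀ hl0 hl1.le)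
    calc π / 2 * (Ring.choose (1 / 2 : ℝ) (n + 4) * l ^ (n + 4)) ^ 2
        = l ^ 8 * (π / 2 * Ring.choose (1 / 2 : ℝ) (n + 4) ^ 2) * (l ^ n) ^ 2 := by ring
      _ ≤ _ := mul_le_of_le_one_right (by positivity) hl
  simp only [Finset.sum_range_succ', zero_add, Nat.reduceAdd, h0, h1, h2, h3, add_assoc] at hb ⊢
  have hb' := mul_le_mul_of_nonneg_left hb (show 0 ≤ l ^ 8 by positivity)
  linarith

theorem cos_add_le_sqrt {x c s : ℝ} (hx : 0 < x) (hc : 0 ≤ c) (hs : 0 ≤ s)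
    (hcs : c ^ 2 + s ^ 2 = 1) :
    c + x ^ 2 * (s * ((1 - c ^ 2) / (2 * c + x))) ≤ √(c ^ 2 + x ^ 2 * s ^ 2) := by
  have hs1 : s ≤ 1 := by nlinarith
  have hd : 0 < 2 * c + x := by linarith
  set q := x ^ 2 * (s * ((1 - c ^ 2) / (2 * c + x))) with hq
  have hqd : q * (2 * c + x) = x ^ 2 * (s * s ^ 2) := by
    rw [hq, ← hcs]
    field_simp
    ring
  have hs3 : s * s ^ 2 ≤ s ^ 2 := mul_le_of_le_one_left (sq_nonneg s) hs1
  have hs31 : s * s ^ 2 ≤ 1 := hs3.trans (by nlinarith)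
  have hq0 : 0 ≤ q := by
    refine nonneg_of_mul_nonneg_left (b := 2 * c + x) ?_ hd
    rw [hqd]
    positivity
  have hqx : q ≤ x := by
    refine le_of_mul_le_mul_right (a := 2 * c + x) ?_ hd
    rw [hqd]
    nlinarith [mul_nonneg hx.le hc, mul_le_mul_of_nonneg_left hs31 (sq_nonneg x)]
  refine Real.le_sqrt_of_sq_le ?_
  nlinarith [mul_le_mul_of_nonneg_left hqx hq0, mul_le_mul_of_nonneg_left hs3 (sq_nonneg x)]

theorem log_le_ellipticE {r x : ℝ} (hx : 0 < x) (hxr : r ^ 2 = 1 - x ^ 2) :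
    1 + x ^ 2 * (-1 / 4 + x / 4 + (1 - x ^ 2 / 4) / 2 * (Real.log (2 + x) - Real.log x)) ≤
      ellipticE r := by
  have hcos : ∀ t ∈ Set.Icc (0 : ℝ) (π / 2), 0 ≤ Real.cos t := fun t ht =>
    Real.cos_nonneg_of_mem_Icc ⟨by linarith [ht.1, Real.pi_pos], ht.2⟩
  have hpi : (0 : ℝ) ≤ π / 2 := by positivity
  have hcont : ContinuousOn (fun t : ℝ => Real.cos t +
      x ^ 2 * (Real.sin t * ((1 - Real.cos t ^ 2) / (2 * Real.cos t + x)))) (Set.uIcc 0 (π / 2)) := by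
    rw [Set.uIcc_of_le hpi]
    have hne : ∀ t ∈ Set.Icc (0 : ℝ) (π / 2), 2 * Real.cos t + x ≠ 0 := fun t ht => by
      have := hcos t ht
      positivity
    fun_prop (disch := assumption)
  have hF : ∫ t in (0 : ℝ)..(π / 2), (Real.cos t +
      x ^ 2 * (Real.sin t * ((1 - Real.cos t ^ 2) / (2 * Real.cos t + x)))) =
      1 + x ^ 2 * (-1 / 4 + x / 4 + (1 - x ^ 2 / 4) / 2 * (Real.log (2 + x) - Real.log x)) := by
    rw [intervalIntegral.integral_eq_sub_of_hasDerivAt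
      (f := fun t => Real.sin t - x ^ 2 * (-Real.cos t ^ 2 / 4 + x * Real.cos t / 4 +
        (1 - x ^ 2 / 4) / 2 * Real.log (2 * Real.cos t + x))) ?_ hcont.intervalIntegrable]
    · simp
      ring
    · intro t ht
      rw [Set.uIcc_of_le hpi] at ht
      have h0 := hcos t ht
      have hd : 2 * Real.cos t + x ≠ 0 := by positivity
      have hc := Real.hasDerivAt_cos t
      have hl := ((hc.const_mul 2).add_const x).log hd
      have h1 := (((hc.pow 2).neg.div_const 4).add ((hc.const_mul x).div_const 4)).add
        (hl.const_mul ((1 - x ^ 2 / 4) / 2))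
      refine ((Real.hasDerivAt_sin t).sub (h1.const_mul (x ^ 2))).congr_deriv ?_
      field_simp
      ring
  rw [← hF, ellipticE]
  refine intervalIntegral.integral_mono_on hpi hcont.intervalIntegrable
    (Continuous.intervalIntegrable (by fun_prop) _ _) fun t ht => ?_
  refine (cos_add_le_sqrt hx (hcos t ht)
    (Real.sin_nonneg_of_mem_Icc ⟨ht.1, ht.2.trans (by linarith [Real.pi_pos])⟩)
    (Real.cos_sq_add_sin_sq t)).trans_eq ?_
  congr 1
  rw [hxr, Real.cos_sq']
  ring

theorem log_five_gt : 1.609 < Real.log 5 := by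
  have h2 := Real.log_two_gt_d9
  have h : Real.log (128 / 125) ≤ 128 / 125 - 1 := Real.log_le_sub_one_of_pos (by norm_num)
  rw [Real.log_div (by norm_num) (by norm_num), show (128 : ℝ) = 2 ^ 7 by norm_num,
    show (125 : ℝ) = 5 ^ 3 by norm_num, Real.log_pow, Real.log_pow] at h
  norm_num at h
  linarith

theorem lt_ellipticE_of_small {r u : ℝ} (hu : 0 < u) (hu5 : u ≤ 1 / 5)
    (hr : r ^ 2 = 1 - (u ^ 2) ^ 2) :
    ((1 - u ^ 5) / (1 - u ^ 4)) ^ 2 < ellipticE r := by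
  refine lt_of_lt_of_le ?_ (log_le_ellipticE (x := u ^ 2) (by positivity) hr)
  have hlog : 5.91 - 10 * u ≤ Real.log (2 + u ^ 2) - Real.log (u ^ 2) := by
    have h1 : Real.log 2 ≤ Real.log (2 + u ^ 2) :=
      Real.log_le_log (by norm_num) (by linarith [sq_nonneg u])
    have h2 : Real.log (5 * u) ≤ 5 * u - 1 := Real.log_le_sub_one_of_pos (by positivity)
    rw [Real.log_mul (by norm_num) hu.ne'] at h2
    rw [Real.log_pow]
    have := log_five_gt
    have := Real.log_two_gt_d9
    norm_num at *
    linarith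
  have hu4 : u ^ 4 ≤ 1 / 625 := by
    calc u ^ 4 ≤ (1 / 5) ^ 4 := by gcongr
      _ = _ := by norm_num
  have hu4p : 0 < u ^ 4 := by positivity
  have hB : 2.7 - 5 * u ≤ -1 / 4 + u ^ 2 / 4 +
      (1 - (u ^ 2) ^ 2 / 4) / 2 * (Real.log (2 + u ^ 2) - Real.log (u ^ 2)) := by
    have := mul_le_mul_of_nonneg_left hlog
      (show 0 ≤ (1 - (u ^ 2) ^ 2 / 4) / 2 by nlinarith)
    nlinarith [sq_nonneg u]
  have hd : 0 < 1 - u ^ 4 := by linarith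
  have key : ((1 - u ^ 5) / (1 - u ^ 4)) ^ 2 < 1 + u ^ 4 * (2.7 - 5 * u) := by
    have hd2 : 0.9968 ≤ (1 - u ^ 4) ^ 2 := by nlinarith
    have h1 : (1 - u ^ 5) ^ 2 ≤ (1 - u ^ 4) ^ 2 + u ^ 4 * (2 * (1 - u)) := by
      have h8 : 0 ≤ u ^ 8 * (1 - u ^ 2) :=
        mul_nonneg (by positivity) (by nlinarith)
      nlinarith
    have h2 : 2 * (1 - u) < (2.7 - 5 * u) * (1 - u ^ 4) ^ 2 := by nlinarith
    rw [div_pow, div_lt_iff₀ (by positivity)]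
    nlinarith [mul_lt_mul_of_pos_left h2 hu4p]
  refine key.trans_le ?_
  have := mul_le_mul_of_nonneg_left hB hu4p.le
  rw [show (u ^ 2) ^ 2 = u ^ 4 by ring] at *
  linarith

theorem quartic_upper_polynomial_pos {u : ℝ} (hu0 : 0 < u) (hu1 : u < 1) :
    (1 + u) ^ 2 * ((1 + u ^ 2) ^ 8 + (1 - u ^ 2) ^ 2 * (1 + u ^ 2) ^ 6 / 4 +
      (1 - u ^ 2) ^ 4 * (1 + u ^ 2) ^ 4 / 64 + (1 - u ^ 2) ^ 6 * (1 + u ^ 2) ^ 2 / 256 +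
      3 / 800 * (1 - u ^ 2) ^ 8) <
    32 / 25 * (1 + u + u ^ 2 + u ^ 3 + u ^ 4) ^ 2 * (1 + u ^ 2) ^ 5 := by
  have h : 0 < (1 - u) ^ 4 * (43 * (1 + u ^ 14) + 258 * (u + u ^ 13) + 853 * (u ^ 2 + u ^ 12) +
      2108 * (u ^ 3 + u ^ 11) + 6783 * (u ^ 4 + u ^ 10) + 6142 * (u ^ 5 + u ^ 9) +
      11777 * (u ^ 6 + u ^ 8) + 5512 * u ^ 7) / 6400 := by
    have : 0 < 1 - u := sub_pos.2 hu1
    positivity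
  linear_combination h

theorem quartic_lower_polynomial_pos {u : ℝ} (hu0 : 1 / 5 ≤ u) (hu1 : u < 1) :
    8149 / 6400 * (1 + u + u ^ 2 + u ^ 3 + u ^ 4) ^ 2 * (1 + u ^ 2) ^ 5 <
    (1 + u) ^ 2 * ((1 + u ^ 2) ^ 8 + (1 - u ^ 2) ^ 2 * (1 + u ^ 2) ^ 6 / 4 +
      (1 - u ^ 2) ^ 4 * (1 + u ^ 2) ^ 4 / 64 + (1 - u ^ 2) ^ 6 * (1 + u ^ 2) ^ 2 / 256 +
      25 / 16384 * (1 - u ^ 2) ^ 8) := by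
  obtain ⟨s, rfl⟩ : ∃ s, u = 1 / 5 + s := ⟨u - 1 / 5, by ring⟩
  have hs0 : 0 ≤ s := by linarith
  have hs1 : s ≤ 1 := by linarith
  have h : 0 < 199288389623 / 762939453125000 + 5767660092459 / 152587890625000 * s +
      11921538367043 / 61035156250000 * s ^ 2 + 403780375036 / 762939453125 * s ^ 3 +
      614188237367 / 488281250000 * s ^ 4 + 943947046053 / 488281250000 * s ^ 5 +
      446810240103 / 195312500000 * s ^ 6 + 4873132409 / 1220703125 * s ^ 7 +
      107259504079 / 31250000000 * s ^ 8 + 6800862047 / 1250000000 * s ^ 9 +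
      8105447263 / 2500000000 * s ^ 10 + 304694323 / 62500000 * s ^ 11 +
      110232297 / 50000000 * s ^ 12 + 10258167 / 5000000 * s ^ 13 +
      581069 / 1600000 * s ^ 14 + 209601 / 800000 * s ^ 15 +
      s ^ 16 * (72293 / 2560000 - 6377 / 512000 * s - 911 / 409600 * s ^ 2) := by
    have : 0 ≤ 72293 / 2560000 - 6377 / 512000 * s - 911 / 409600 * s ^ 2 := by nlinarith
    positivity
  linear_combination h

theorem one_sub_pow_five_div {u : ℝ} (hu0 : 0 < u) (hu1 : u < 1) :
    (1 - u ^ 5) / (1 - u ^ 4) = (1 + u + u ^ 2 + u ^ 3 + u ^ 4) / ((1 + u) * (1 + u ^ 2)) := by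
  have h4 : u ^ 4 < 1 := pow_lt_one₀ hu0.le hu1 (by norm_num)
  rw [div_eq_div_iff (by linarith) (by positivity)]
  ring

theorem ellipticE_eq_integral_norm_sq {r u : ℝ} (hr : r ^ 2 = 1 - (u ^ 2) ^ 2) :
    ellipticE r = (1 + u ^ 2) / 2 * ∫ t in (0 : ℝ)..(π / 2),
      ‖1 + ((1 - u ^ 2) / (1 + u ^ 2) : ℝ) * Complex.exp ((2 * t : ℝ) * Complex.I)‖ :=
  ellipticE_eq_integral_norm (sq_nonneg u) hr

theorem one_sub_sq_div_mem {u : ℝ} (hu0 : 0 < u) (hu1 : u < 1) :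
    0 ≤ (1 - u ^ 2) / (1 + u ^ 2) ∧ (1 - u ^ 2) / (1 + u ^ 2) < 1 := by
  have h2 : u ^ 2 < 1 := pow_lt_one₀ hu0.le hu1 (by norm_num)
  have : 0 < u ^ 2 := by positivity
  exact ⟨div_nonneg (by linarith) (by positivity), (div_lt_one (by positivity)).2 (by linarith)⟩

theorem lt_ellipticE_of_large {r u : ℝ} (hu5 : 1 / 5 ≤ u) (hu1 : u < 1)
    (hr : r ^ 2 = 1 - (u ^ 2) ^ 2) :
    ((1 - u ^ 5) / (1 - u ^ 4)) ^ 2 < ellipticE r := by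
  have hu0 : 0 < u := by linarith
  obtain ⟨hl0, hl1⟩ := one_sub_sq_div_mem hu0 hu1
  rw [ellipticE_eq_integral_norm_sq hr, one_sub_pow_five_div hu0 hu1]
  refine lt_of_lt_of_le ?_ (mul_le_mul_of_nonneg_left (le_integral_norm_one_add_mul_exp hl0 hl1)
    (by positivity))
  have hP := quartic_lower_polynomial_pos hu5 hu1
  set P := (1 + u ^ 2) ^ 8 + (1 - u ^ 2) ^ 2 * (1 + u ^ 2) ^ 6 / 4 +
      (1 - u ^ 2) ^ 4 * (1 + u ^ 2) ^ 4 / 64 + (1 - u ^ 2) ^ 6 * (1 + u ^ 2) ^ 2 / 256 +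
      25 / 16384 * (1 - u ^ 2) ^ 8 with hPdef
  have hpi := Real.pi_gt_d4
  calc ((1 + u + u ^ 2 + u ^ 3 + u ^ 4) / ((1 + u) * (1 + u ^ 2))) ^ 2
      < 6400 / 8149 * P / (1 + u ^ 2) ^ 7 := by
        rw [div_pow, div_lt_div_iff₀ (by positivity) (by positivity)]
        nlinarith [mul_lt_mul_of_pos_right hP (show 0 < (1 + u ^ 2) ^ 2 by positivity)]
    _ ≤ π / 4 * P / (1 + u ^ 2) ^ 7 := by
        have : 6400 / 8149 ≤ π / 4 := by linarith
        gcongr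
    _ = _ := by
        rw [hPdef]
        field_simp
        ring

theorem ellipticE_lt {r u : ℝ} (hu0 : 0 < u) (hu1 : u < 1) (hr : r ^ 2 = 1 - (u ^ 2) ^ 2) :
    ellipticE r < π / 2 * (4 / 5 * ((1 - u ^ 5) / (1 - u ^ 4))) ^ 2 := by
  obtain ⟨hl0, hl1⟩ := one_sub_sq_div_mem hu0 hu1
  rw [ellipticE_eq_integral_norm_sq hr, one_sub_pow_five_div hu0 hu1]
  refine (mul_le_mul_of_nonneg_left (integral_norm_one_add_mul_exp_le_quartic hl0 hl1)
    (by positivity)).trans_lt ?_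
  have hP := quartic_upper_polynomial_pos hu0 hu1
  set P := (1 + u ^ 2) ^ 8 + (1 - u ^ 2) ^ 2 * (1 + u ^ 2) ^ 6 / 4 +
      (1 - u ^ 2) ^ 4 * (1 + u ^ 2) ^ 4 / 64 + (1 - u ^ 2) ^ 6 * (1 + u ^ 2) ^ 2 / 256 +
      3 / 800 * (1 - u ^ 2) ^ 8 with hPdef
  have hpi := Real.pi_gt_d4
  set l := (1 - u ^ 2) / (1 + u ^ 2) with hl
  calc (1 + u ^ 2) / 2 * (π / 2 * (1 + l ^ 2 / 4 + l ^ 4 / 64 + l ^ 6 / 256) +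
        l ^ 8 * (2 - π / 2 * (325 / 256)))
      ≤ (1 + u ^ 2) / 2 * (π / 2 * (1 + l ^ 2 / 4 + l ^ 4 / 64 + l ^ 6 / 256) +
        l ^ 8 * (π / 2 * (3 / 800))) := by
        have : 2 - π / 2 * (325 / 256) ≤ π / 2 * (3 / 800) := by linarith
        gcongr
    _ = π / 4 * (P / (1 + u ^ 2) ^ 7) := by
        rw [hPdef, hl]
        field_simp
        ring
    _ < π / 4 * (32 / 25 * ((1 + u + u ^ 2 + u ^ 3 + u ^ 4) / ((1 + u) * (1 + u ^ 2))) ^ 2) := by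
        refine mul_lt_mul_of_pos_left ?_ (by positivity)
        rw [div_pow, ← mul_div_assoc, div_lt_div_iff₀ (by positivity) (by positivity)]
        nlinarith [mul_lt_mul_of_pos_right hP (show 0 < (1 + u ^ 2) ^ 2 by positivity)]
    _ = _ := by ring

theorem ellipticE_S52_bounds (r : ℝ) (hr : r ∈ Set.Ioo (0:ℝ) 1) :
    25 / (8 * π) * S52 (Real.sqrt (1 - r ^ 2)) < 2 / π * ellipticE r ∧
    2 / π * ellipticE r < S52 (Real.sqrt (1 - r ^ 2)) := by
  obtain ⟨h0, h1⟩ := hr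
  have hr2 : r ^ 2 < 1 := pow_lt_one₀ h0.le h1 (by norm_num)
  have hr2p : 0 < r ^ 2 := by positivity
  obtain ⟨u, hu0, hux⟩ : ∃ u : ℝ, 0 < u ∧ Real.sqrt (1 - r ^ 2) = u ^ 2 :=
    ⟨√√(1 - r ^ 2), Real.sqrt_pos.2 (Real.sqrt_pos.2 (by linarith)),
      (Real.sq_sqrt (Real.sqrt_nonneg _)).symm⟩
  have hru : r ^ 2 = 1 - (u ^ 2) ^ 2 := by
    rw [← hux, Real.sq_sqrt (by linarith)]
    ring
  have hu1 : u < 1 := by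
    by_contra! h
    nlinarith [one_le_pow₀ h (n := 4)]
  have hS : S52 (Real.sqrt (1 - r ^ 2)) = (4 / 5 * ((1 - u ^ 5) / (1 - u ^ 4))) ^ 2 := by
    have h5 : (u ^ 2) ^ ((5 : ℝ) / 2) = u ^ 5 := by
      rw [← Real.rpow_natCast u 2, ← Real.rpow_mul hu0.le, ← Real.rpow_natCast u 5]
      norm_num
    rw [S52, hux, h5]
    ring
  have hlow : ((1 - u ^ 5) / (1 - u ^ 4)) ^ 2 < ellipticE r := by
    rcases le_total u (1 / 5) with h | h
    · exact lt_ellipticE_of_small hu0 h hru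
    · exact lt_ellipticE_of_large h hu1 hru
  have hup := ellipticE_lt hu0 hu1 hru
  have hpi := Real.pi_pos
  rw [hS]
  constructor
  · calc 25 / (8 * π) * (4 / 5 * ((1 - u ^ 5) / (1 - u ^ 4))) ^ 2
        = 2 / π * ((1 - u ^ 5) / (1 - u ^ 4)) ^ 2 := by field_simp; ring
      _ < _ := mul_lt_mul_of_pos_left hlow (by positivity)
  · calc 2 / π * ellipticE r
        < 2 / π * (π / 2 * (4 / 5 * ((1 - u ^ 5) / (1 - u ^ 4))) ^ 2) :=
          mul_lt_mul_of_pos_left hup (by positivity)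
      _ = _ := by field_simp
end
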